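/- arXiv:1211.0091 — 2 statements merged into one kernel-verified Lean document; each statement's English description precedes it below -/
import Mathlib

section
/- Let S be the set of positions p : ZMod 6 → ℕ such that some symmetry q of p satisfies q 0 + q 1 = q 3 + q 4, q 1 + q 2 = q 4 + q 5, (q 0) XOR (q 2) XOR (q 4) = 0 (bitwise XOR of natural numbers, i.e., Nim-sum zero), and q 0 ≤ q j for all j. Then S satisfies conditions (I) and (II) for the game CN(6,4): (I) for every p ∈ S, every legal move of CN(6,4) from p leads to a position not in S; (II) for every position p ∉ S there is a legal move of CN(6,4) from p to some position in S. Hence S is the set of losing positions of CN(6,4). -/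
/-- A legal move of circular Nim CN(n,k): choose an index `i`; the new position `p'`
is pointwise ≤ `p`, agrees with `p` outside the arc `{i, i+1, …, i+(k-1)}`, and differs from `p`. -/
def IsMove (n k : ℕ) (p p' : ZMod n → ℕ) : Prop :=
  ∃ i : ZMod n, (∀ j, p' j ≤ p j) ∧
    (∀ j : ZMod n, (∀ t : ℕ, t < k → j ≠ i + (t : ZMod n)) → p' j = p j) ∧
    p' ≠ p

/-- `q` is a symmetry (rotation or reflection) of the position `p`. -/
def IsSymmPos (n : ℕ) (p q : ZMod n → ℕ) : Prop :=
  ∃ l : ZMod n, (∀ j, q j = p (j + l)) ∨ (∀ j, q j = p (l - j))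

/-- Condition (I): every legal move from a position in `S` leads outside of `S`. -/
def CondI (n k : ℕ) (S : Set (ZMod n → ℕ)) : Prop :=
  ∀ p ∈ S, ∀ p', IsMove n k p p' → p' ∉ S

/-- Condition (II): from every position not in `S` there is a legal move into `S`. -/
def CondII (n k : ℕ) (S : Set (ZMod n → ℕ)) : Prop :=
  ∀ p, p ∉ S → ∃ p', IsMove n k p p' ∧ p' ∈ S

/-- Abstract membership: even stacks `x`, opposite stacks `y`. -/
def PosP (x1 x2 x3 y1 y2 y3 : ℕ) : Prop :=
  ∃ d, (y1 = x1 + d ∧ y2 = x2 + d ∧ y3 = x3 + d ∧ x1 ^^^ x2 ^^^ x3 = 0) ∨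
    (x1 = y1 + d ∧ x2 = y2 + d ∧ x3 = y3 + d ∧ y1 ^^^ y2 ^^^ y3 = 0)

theorem xor_s12 {a b c : ℕ} (h : a ^^^ b ^^^ c = 0) : b ^^^ a ^^^ c = 0 := by
  rwa [Nat.xor_comm b a]

theorem xor_s23 {a b c : ℕ} (h : a ^^^ b ^^^ c = 0) : a ^^^ c ^^^ b = 0 := by
  rw [Nat.xor_assoc, Nat.xor_comm c b, ← Nat.xor_assoc]; exact h

theorem PosP.s12 {a b c d e f : ℕ} (h : PosP a b c d e f) : PosP b a c e d f := by
  obtain ⟨k, ⟨h1, h2, h3, h4⟩ | ⟨h1, h2, h3, h4⟩⟩ := h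
  · exact ⟨k, Or.inl ⟨h2, h1, h3, xor_s12 h4⟩⟩
  · exact ⟨k, Or.inr ⟨h2, h1, h3, xor_s12 h4⟩⟩

theorem PosP.s23 {a b c d e f : ℕ} (h : PosP a b c d e f) : PosP a c b d f e := by
  obtain ⟨k, ⟨h1, h2, h3, h4⟩ | ⟨h1, h2, h3, h4⟩⟩ := h
  · exact ⟨k, Or.inl ⟨h1, h3, h2, xor_s23 h4⟩⟩
  · exact ⟨k, Or.inr ⟨h1, h3, h2, xor_s23 h4⟩⟩

theorem PosP.swap {a b c d e f : ℕ} (h : PosP a b c d e f) : PosP d e f a b c := by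
  obtain ⟨k, h | h⟩ := h
  · exact ⟨k, Or.inr h⟩
  · exact ⟨k, Or.inl h⟩

/-- There is a (possibly trivial) move into `PosP`. -/
def Good (e1 e2 e3 o1 o2 o3 : ℕ) : Prop :=
  ∃ x1 x2 x3 y1 y2 y3, x1 ≤ e1 ∧ x2 ≤ e2 ∧ x3 ≤ e3 ∧ y1 ≤ o1 ∧ y2 ≤ o2 ∧ y3 ≤ o3 ∧
    PosP x1 x2 x3 y1 y2 y3 ∧
    ((x1 = e1 ∧ y2 = o2) ∨ (x1 = e1 ∧ y3 = o3) ∨ (x2 = e2 ∧ y1 = o1) ∨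
     (x2 = e2 ∧ y3 = o3) ∨ (x3 = e3 ∧ y1 = o1) ∨ (x3 = e3 ∧ y2 = o2))

theorem Good.s12 {a b c d e f : ℕ} (h : Good a b c d e f) : Good b a c e d f := by
  obtain ⟨x1, x2, x3, y1, y2, y3, h1, h2, h3, h4, h5, h6, hp, hk⟩ := h
  exact ⟨x2, x1, x3, y2, y1, y3, h2, h1, h3, h5, h4, h6, hp.s12, by tauto⟩

theorem Good.s23 {a b c d e f : ℕ} (h : Good a b c d e f) : Good a c b d f e := by
  obtain ⟨x1, x2, x3, y1, y2, y3, h1, h2, h3, h4, h5, h6, hp, hk⟩ := h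
  exact ⟨x1, x3, x2, y1, y3, y2, h1, h3, h2, h4, h6, h5, hp.s23, by tauto⟩

theorem Good.swap {a b c d e f : ℕ} (h : Good a b c d e f) : Good d e f a b c := by
  obtain ⟨x1, x2, x3, y1, y2, y3, h1, h2, h3, h4, h5, h6, hp, hk⟩ := h
  exact ⟨y1, y2, y3, x1, x2, x3, h4, h5, h6, h1, h2, h3, hp.swap, by tauto⟩

/-- Nim on three heaps: one heap can be reduced (weakly) to reach nim-sum zero. -/
theorem nim3 (a b c : ℕ) : (∃ x ≤ a, x ^^^ b ^^^ c = 0) ∨ (∃ x ≤ b, a ^^^ x ^^^ c = 0) ∨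
    (∃ x ≤ c, a ^^^ b ^^^ x = 0) := by
  by_cases h : a ^^^ b ^^^ c = 0
  · exact Or.inl ⟨a, le_rfl, h⟩
  · rcases Nat.xor_trichotomy h with h | h | h
    · exact Or.inl ⟨_, h.le, by rw [Nat.xor_assoc, Nat.xor_self]⟩
    · exact Or.inr (Or.inl ⟨_, h.le, by
        apply xor_s23; rw [Nat.xor_comm a c, Nat.xor_self]⟩)
    · exact Or.inr (Or.inr ⟨_, h.le, by rw [Nat.xor_self]⟩)

theorem good_core (e1 e2 e3 o1 o2 o3 : ℕ) (h12 : o1 + e2 ≤ o2 + e1) (h23 : o2 + e3 ≤ o3 + e2)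
    (h2 : e2 ≤ o2) : Good e1 e2 e3 o1 o2 o3 := by
  by_cases hc : o2 ≤ o1 + e2
  · obtain ⟨d, rfl⟩ := Nat.exists_eq_add_of_le h2
    obtain ⟨a, rfl⟩ : ∃ a, o1 = a + d := ⟨o1 - d, by omega⟩
    rcases nim3 a e2 e3 with ⟨x, hx, h⟩ | ⟨x, hx, h⟩ | ⟨x, hx, h⟩
    · exact ⟨x, e2, e3, x + d, e2 + d, e3 + d, by omega, by omega, by omega, by omega, by omega,
        by omega, ⟨d, Or.inl ⟨rfl, rfl, rfl, h⟩⟩, by omega⟩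
    · exact ⟨a, x, e3, a + d, x + d, e3 + d, by omega, by omega, by omega, by omega, by omega,
        by omega, ⟨d, Or.inl ⟨rfl, rfl, rfl, h⟩⟩, by omega⟩
    · exact ⟨a, e2, x, a + d, e2 + d, x + d, by omega, by omega, by omega, by omega, by omega,
        by omega, ⟨d, Or.inl ⟨rfl, rfl, rfl, h⟩⟩, by omega⟩
  · exact ⟨0, min e2 e3, min e2 e3, o1, min e2 e3 + o1, min e2 e3 + o1, by omega, by omega,
      by omega, by omega, by omega, by omega,
      ⟨o1, Or.inl ⟨by omega, rfl, rfl, by simp⟩⟩, by omega⟩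

theorem good_sorted (e1 e2 e3 o1 o2 o3 : ℕ) (h12 : o1 + e2 ≤ o2 + e1)
    (h23 : o2 + e3 ≤ o3 + e2) : Good e1 e2 e3 o1 o2 o3 := by
  rcases le_total e2 o2 with h | h
  · exact good_core _ _ _ _ _ _ h12 h23 h
  · have := good_core o3 o2 o1 e3 e2 e1 (by omega) (by omega) h
    exact this.swap.s12.s23.s12

theorem good_all (e1 e2 e3 o1 o2 o3 : ℕ) : Good e1 e2 e3 o1 o2 o3 := by
  rcases le_total (o1 + e2) (o2 + e1) with h | h <;>
  rcases le_total (o2 + e3) (o3 + e2) with h' | h' <;>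
  rcases le_total (o1 + e3) (o3 + e1) with h'' | h''
  · exact good_sorted _ _ _ _ _ _ h h'
  · exact good_sorted _ _ _ _ _ _ h h'
  · exact (good_sorted e1 e3 e2 o1 o3 o2 (by omega) (by omega)).s23
  · exact (good_sorted e3 e1 e2 o3 o1 o2 (by omega) (by omega)).s12.s23
  · exact (good_sorted e2 e1 e3 o2 o1 o3 (by omega) (by omega)).s12
  · exact (good_sorted e2 e3 e1 o2 o3 o1 (by omega) (by omega)).s23.s12
  · exact (good_sorted e3 e2 e1 o3 o2 o1 (by omega) (by omega)).s12.s23.s12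
  · exact (good_sorted e3 e2 e1 o3 o2 o1 (by omega) (by omega)).s12.s23.s12

/-- Keeping `e1` and `o2`, one cannot go from `PosP` to a different `PosP`. -/
theorem rigid {e1 e2 e3 o1 o2 o3 x1 x2 x3 y1 y2 y3 : ℕ} (h : PosP e1 e2 e3 o1 o2 o3)
    (h' : PosP x1 x2 x3 y1 y2 y3) (h2 : x2 ≤ e2) 
    (h4 : y1 ≤ o1) (k1 : x1 = e1) (k2 : y2 = o2) :
    x1 = e1 ∧ x2 = e2 ∧ x3 = e3 ∧ y1 = o1 ∧ y2 = o2 ∧ y3 = o3 := by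
  have key : ∀ a b c c' : ℕ, a ^^^ b ^^^ c = 0 → a ^^^ b ^^^ c' = 0 → c = c' := by
    intro a b c c' h h'
    rw [Nat.xor_eq_zero_iff] at h h'
    rw [← h, h']
  obtain ⟨d, ⟨a1, a2, a3, a4⟩ | ⟨a1, a2, a3, a4⟩⟩ := h <;>
  obtain ⟨d', ⟨b1, b2, b3, b4⟩ | ⟨b1, b2, b3, b4⟩⟩ := h'
  · have i1 : x1 = e1 := by omega
    have i2 : x2 = e2 := by omega
    rw [i1, i2] at b4
    have := key _ _ _ _ a4 b4
    omega
  · have i1 : y1 = e1 := by omega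
    have i2 : y2 = e2 := by omega
    rw [i1, i2] at b4
    have := key _ _ _ _ a4 b4
    omega
  · have i1 : x1 = o1 := by omega
    have i2 : x2 = o2 := by omega
    rw [i1, i2] at b4
    have := key _ _ _ _ a4 b4
    omega
  · have i1 : y1 = o1 := by omega
    have i2 : y2 = o2 := by omega
    rw [i1, i2] at b4
    have := key _ _ _ _ a4 b4
    omega

theorem zcases : ∀ l : ZMod 6, l = 0 ∨ l = 1 ∨ l = 2 ∨ l = 3 ∨ l = 4 ∨ l = 5 := by decide

theorem ztab : (1 + 1 : ZMod 6) = 2 ∧ (1 + 2 : ZMod 6) = 3 ∧ (1 + 3 : ZMod 6) = 4 ∧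
    (1 + 4 : ZMod 6) = 5 ∧ (1 + 5 : ZMod 6) = 0 ∧ (2 + 1 : ZMod 6) = 3 ∧ (2 + 2 : ZMod 6) = 4 ∧
    (2 + 3 : ZMod 6) = 5 ∧ (2 + 4 : ZMod 6) = 0 ∧ (2 + 5 : ZMod 6) = 1 ∧ (3 + 1 : ZMod 6) = 4 ∧
    (3 + 2 : ZMod 6) = 5 ∧ (3 + 3 : ZMod 6) = 0 ∧ (3 + 4 : ZMod 6) = 1 ∧ (3 + 5 : ZMod 6) = 2 ∧
    (4 + 1 : ZMod 6) = 5 ∧ (4 + 2 : ZMod 6) = 0 ∧ (4 + 3 : ZMod 6) = 1 ∧ (4 + 4 : ZMod 6) = 2 ∧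
    (4 + 5 : ZMod 6) = 3 ∧ (5 + 1 : ZMod 6) = 0 ∧ (5 + 2 : ZMod 6) = 1 ∧ (5 + 3 : ZMod 6) = 2 ∧
    (5 + 4 : ZMod 6) = 3 ∧ (5 + 5 : ZMod 6) = 4 := by decide

theorem zneg : (-1 : ZMod 6) = 5 ∧ (-2 : ZMod 6) = 4 ∧ (-3 : ZMod 6) = 3 ∧
    (-4 : ZMod 6) = 2 ∧ (-5 : ZMod 6) = 1 := by decide

/-- `PosP` for positions on the circle. -/
def PosQ (p : ZMod 6 → ℕ) : Prop := PosP (p 0) (p 2) (p 4) (p 3) (p 5) (p 1)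

theorem posQ_rot {p q : ZMod 6 → ℕ} (h : PosQ q) (hq : ∀ j, p (j + 1) = q j) : PosQ p := by
  have h0 := hq 0
  have h1 := hq 1
  have h2 := hq 2
  have h3 := hq 3
  have h4 := hq 4
  have h5 := hq 5
  simp only [ztab, zero_add] at h0 h1 h2 h3 h4 h5
  unfold PosQ at *
  rw [h0, h1, h2, h3, h4, h5]
  exact h.swap.s12.s23

theorem posQ_add {p : ZMod 6 → ℕ} (l : ZMod 6) (h : PosQ (fun j => p (j + l))) : PosQ p := by
  have step : ∀ l : ZMod 6, PosQ (fun j => p (j + l)) → PosQ (fun j => p (j + (l - 1))) := by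
    intro l h
    refine posQ_rot h fun j => ?_
    show p (j + 1 + (l - 1)) = p (j + l)
    congr 1; ring
  have main : ∀ n : ℕ, ∀ l : ZMod 6, PosQ (fun j => p (j + l)) →
      PosQ (fun j => p (j + (l - n))) := by
    intro n
    induction n with
    | zero => intro l h; simpa using h
    | succ n ih =>
      intro l h
      have := step _ (ih l h)
      convert this using 4
      push_cast; ring
  have := main l.val l h
  simpa using this

theorem posQ_neg {p : ZMod 6 → ℕ} (h : PosQ (fun j => p (-j))) : PosQ p := by
  unfold PosQ at *
  simp only [zneg, neg_zero] at h
  exact h.s23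

theorem mem_iff (p : ZMod 6 → ℕ) : (∃ q : ZMod 6 → ℕ, IsSymmPos 6 p q ∧
      q 0 + q 1 = q 3 + q 4 ∧ q 1 + q 2 = q 4 + q 5 ∧
      q 0 ^^^ q 2 ^^^ q 4 = 0 ∧ ∀ j, q 0 ≤ q j) ↔ PosQ p := by
  constructor
  · rintro ⟨q, ⟨l, hs⟩, h1, h2, h3, h4⟩
    have hq : PosQ q := by
      have := h4 3
      exact ⟨q 3 - q 0, Or.inl ⟨by omega, by omega, by omega, h3⟩⟩
    rcases hs with hs | hs
    · have : q = fun j => p (j + l) := funext hs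
      rw [this] at hq
      exact posQ_add l hq
    · have : q = fun j => p (l - j) := funext hs
      rw [this] at hq
      refine posQ_add l (posQ_neg ?_)
      convert hq using 3
      ring
  · intro h
    have main : ∀ l : ZMod 6, ∀ d, p (0 + l) ≤ p (2 + l) → p (0 + l) ≤ p (4 + l) →
        p (3 + l) = p (0 + l) + d → p (5 + l) = p (2 + l) + d → p (1 + l) = p (4 + l) + d →
        p (0 + l) ^^^ p (2 + l) ^^^ p (4 + l) = 0 → (∃ q : ZMod 6 → ℕ, IsSymmPos 6 p q ∧
      q 0 + q 1 = q 3 + q 4 ∧ q 1 + q 2 = q 4 + q 5 ∧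
      q 0 ^^^ q 2 ^^^ q 4 = 0 ∧ ∀ j, q 0 ≤ q j) := by
      intro l d a1 a2 a3 a4 a5 a6
      refine ⟨fun j => p (j + l), ⟨l, Or.inl fun j => rfl⟩, ?_, ?_, a6, ?_⟩
      · dsimp only; omega
      · dsimp only; omega
      · intro j
        dsimp only
        rcases zcases j with rfl | rfl | rfl | rfl | rfl | rfl <;> omega
    obtain ⟨d, ⟨h1, h2, h3, h4⟩ | ⟨h1, h2, h3, h4⟩⟩ := h
    · by_cases c0 : p 0 ≤ p 2 ∧ p 0 ≤ p 4
      · apply main 0 d <;> simp only [ztab, add_zero] <;> first | omega | assumption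
      by_cases c2 : p 2 ≤ p 4
      · apply main 2 d <;> simp only [ztab, zero_add] <;>
          first | omega | exact xor_s23 (xor_s12 h4)
      · apply main 4 d <;> simp only [ztab, zero_add] <;>
          first | omega | exact xor_s12 (xor_s23 h4)
    · by_cases c0 : p 3 ≤ p 5 ∧ p 3 ≤ p 1
      · apply main 3 d <;> simp only [ztab, zero_add] <;> first | omega | assumption
      by_cases c2 : p 5 ≤ p 1
      · apply main 5 d <;> simp only [ztab, zero_add] <;>
          first | omega | exact xor_s23 (xor_s12 h4)
      · apply main 1 d <;> simp only [ztab, zero_add] <;>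
          first | omega | exact xor_s12 (xor_s23 h4)

theorem move_iff (p p' : ZMod 6 → ℕ) : IsMove 6 4 p p' ↔ (∀ j, p' j ≤ p j) ∧ p' ≠ p ∧
    ∃ i, p' i = p i ∧ p' (i + 1) = p (i + 1) := by
  have t1 : ∀ i : ZMod 6, ∀ t : ℕ, t < 4 → i + 4 ≠ i + (t : ZMod 6) := by decide
  have t2 : ∀ i : ZMod 6, ∀ t : ℕ, t < 4 → i + 4 + 1 ≠ i + (t : ZMod 6) := by decide
  have t3 : ∀ i j : ZMod 6, (∀ t : ℕ, t < 4 → j ≠ i + 2 + (t : ZMod 6)) → j = i ∨ j = i + 1 := by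
    decide
  constructor
  · rintro ⟨i, h1, h2, h3⟩
    exact ⟨h1, h3, i + 4, h2 _ (t1 i), h2 _ (t2 i)⟩
  · rintro ⟨h1, h3, i, h4, h5⟩
    refine ⟨i + 2, h1, fun j hj => ?_, h3⟩
    rcases t3 i j hj with rfl | rfl <;> assumption

theorem posQ_rigid {p p' : ZMod 6 → ℕ} (h : PosQ p) (h' : PosQ p') (hle : ∀ j, p' j ≤ p j)
    (hi : ∃ i, p' i = p i ∧ p' (i + 1) = p (i + 1)) : p' = p := by
  obtain ⟨i, k1, k2⟩ := hi
  unfold PosQ at h h'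
  have : p' 0 = p 0 ∧ p' 1 = p 1 ∧ p' 2 = p 2 ∧ p' 3 = p 3 ∧ p' 4 = p 4 ∧ p' 5 = p 5 := by
    rcases zcases i with rfl | rfl | rfl | rfl | rfl | rfl <;>
      simp only [ztab, zero_add] at k1 k2
    · have := rigid h.s23 h'.s23 (hle _) (hle _) k1 k2
      tauto
    · have := rigid h.s12.s23 h'.s12.s23 (hle _) (hle _) k2 k1
      tauto
    · have := rigid h.s12 h'.s12 (hle _) (hle _) k1 k2
      tauto
    · have := rigid h.s23.s12 h'.s23.s12 (hle _) (hle _) k2 k1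
      tauto
    · have := rigid h.s12.s23.s12 h'.s12.s23.s12 (hle _) (hle _) k1 k2
      tauto
    · have := rigid h h' (hle _) (hle _) k2 k1
      tauto
  obtain ⟨a0, a1, a2, a3, a4, a5⟩ := this
  funext j
  rcases zcases j with rfl | rfl | rfl | rfl | rfl | rfl <;> assumption

theorem CN_6_4_losing :
    CondI 6 4 {p : ZMod 6 → ℕ | ∃ q : ZMod 6 → ℕ, IsSymmPos 6 p q ∧
      q 0 + q 1 = q 3 + q 4 ∧ q 1 + q 2 = q 4 + q 5 ∧
      q 0 ^^^ q 2 ^^^ q 4 = 0 ∧ ∀ j, q 0 ≤ q j} ∧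
    CondII 6 4 {p : ZMod 6 → ℕ | ∃ q : ZMod 6 → ℕ, IsSymmPos 6 p q ∧
      q 0 + q 1 = q 3 + q 4 ∧ q 1 + q 2 = q 4 + q 5 ∧
      q 0 ^^^ q 2 ^^^ q 4 = 0 ∧ ∀ j, q 0 ≤ q j} := by
  constructor
  · intro p hp p' hm hp'
    rw [Set.mem_setOf_eq, mem_iff] at hp hp'
    rw [move_iff] at hm
    obtain ⟨h1, h2, h3⟩ := hm
    exact h2 (posQ_rigid hp hp' h1 h3)
  · intro p hp
    rw [Set.mem_setOf_eq, mem_iff] at hp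
    obtain ⟨x1, x2, x3, y1, y2, y3, h1, h2, h3, h4, h5, h6, hP, hk⟩ :=
      good_all (p 0) (p 2) (p 4) (p 3) (p 5) (p 1)
    obtain ⟨p', e0, e1, e2, e3, e4, e5⟩ : ∃ p' : ZMod 6 → ℕ, p' 0 = x1 ∧ p' 1 = y3 ∧ p' 2 = x2 ∧
        p' 3 = y1 ∧ p' 4 = x3 ∧ p' 5 = y2 :=
      ⟨(![x1, y3, x2, y1, x3, y2] : Fin 6 → ℕ), rfl, rfl, rfl, rfl, rfl, rfl⟩
    subst e0 e1 e2 e3 e4 e5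
    have hQ : PosQ p' := hP
    refine ⟨p', ?_, ?_⟩
    · rw [move_iff]
      refine ⟨?_, ?_, ?_⟩
      · intro j
        rcases zcases j with rfl | rfl | rfl | rfl | rfl | rfl <;> assumption
      · rintro rfl
        exact hp hQ
      · rcases hk with ⟨k, k'⟩ | ⟨k, k'⟩ | ⟨k, k'⟩ | ⟨k, k'⟩ | ⟨k, k'⟩ | ⟨k, k'⟩
        · exact ⟨5, k', k⟩
        · exact ⟨0, k, k'⟩
        · exact ⟨2, k, k'⟩
        · exact ⟨1, k', k⟩
        · exact ⟨3, k', k⟩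
        · exact ⟨4, k, k'⟩
    · rw [Set.mem_setOf_eq, mem_iff]
      exact hQ
end

section
/- Let S be the set of positions p : ZMod 8 → ℕ such that some symmetry q of p satisfies q 0 = 0, q 1 = q 7, q 2 + q 3 = q 1, q 5 + q 6 = q 1, and q 4 = min(q 1, q 2 + q 6) (i.e., up to rotation and reflection p has the form (0,x,a₁,b₁,e,b₂,a₂,x) with a₁ + b₁ = a₂ + b₂ = x and e = min(x, a₁ + a₂)). Then S satisfies conditions (I) and (II) for the game CN(8,6): (I) for every p ∈ S, every legal move of CN(8,6) from p leads to a position not in S; (II) for every position p ∉ S there is a legal move of CN(8,6) from p to some position in S. Hence S is the set of losing positions of CN(8,6). -/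
/-- The normal form of a losing position, with the zero in front. -/
def Form (q0 q1 q2 q3 q4 q5 q6 q7 : ℕ) : Prop :=
  q0 = 0 ∧ q1 = q7 ∧ q2 + q3 = q1 ∧ q5 + q6 = q1 ∧ q4 = min q1 (q2 + q6)

theorem Form.refl {a b c d e f g h : ℕ} (x : Form a b c d e f g h) : Form a h g f e d c b := by
  unfold Form at *; omega

/-- Some rotation is in normal form. -/
def InS (a b c d e f g h : ℕ) : Prop :=
  Form a b c d e f g h ∨ Form b c d e f g h a ∨ Form c d e f g h a b ∨ Form d e f g h a b c ∨
  Form e f g h a b c d ∨ Form f g h a b c d e ∨ Form g h a b c d e f ∨ Form h a b c d e f g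

theorem InS.rot {a b c d e f g h : ℕ} (x : InS b c d e f g h a) : InS a b c d e f g h := by
  unfold InS at *; tauto

theorem InS.rf {a b c d e f g h : ℕ} (x : InS a h g f e d c b) : InS a b c d e f g h := by
  unfold InS at *
  rcases x with x | x | x | x | x | x | x | x <;> have := x.refl <;> tauto

/-- Two cyclically adjacent stacks agree. -/
def Pr (a b c d e f g h a' b' c' d' e' f' g' h' : ℕ) : Prop :=
  (a' = a ∧ b' = b) ∨ (b' = b ∧ c' = c) ∨ (c' = c ∧ d' = d) ∨ (d' = d ∧ e' = e) ∨
  (e' = e ∧ f' = f) ∨ (f' = f ∧ g' = g) ∨ (g' = g ∧ h' = h) ∨ (h' = h ∧ a' = a)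

def G (a b c d e f g h : ℕ) : Prop :=
  ∃ a' b' c' d' e' f' g' h' : ℕ,
    (a' ≤ a ∧ b' ≤ b ∧ c' ≤ c ∧ d' ≤ d ∧ e' ≤ e ∧ f' ≤ f ∧ g' ≤ g ∧ h' ≤ h) ∧
    Pr a b c d e f g h a' b' c' d' e' f' g' h' ∧ InS a' b' c' d' e' f' g' h'

theorem r1 {a b c d e f g h : ℕ} (x : G b c d e f g h a) : G a b c d e f g h := by
  obtain ⟨b', c', d', e', f', g', h', a', hle, hp, hs⟩ := x
  refine ⟨a', b', c', d', e', f', g', h', by tauto, ?_, hs.rot⟩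
  unfold Pr at *; tauto

theorem rf {a b c d e f g h : ℕ} (x : G a h g f e d c b) : G a b c d e f g h := by
  obtain ⟨a', h', g', f', e', d', c', b', hle, hp, hs⟩ := x
  refine ⟨a', b', c', d', e', f', g', h', by tauto, ?_, hs.rf⟩
  unfold Pr at *; tauto

theorem r2 {a b c d e f g h : ℕ} (x : G c d e f g h a b) : G a b c d e f g h := r1 (r1 x)
theorem r3 {a b c d e f g h : ℕ} (x : G d e f g h a b c) : G a b c d e f g h := r1 (r2 x)
theorem r4 {a b c d e f g h : ℕ} (x : G e f g h a b c d) : G a b c d e f g h := r1 (r3 x)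
theorem r5 {a b c d e f g h : ℕ} (x : G f g h a b c d e) : G a b c d e f g h := r1 (r4 x)
theorem r6 {a b c d e f g h : ℕ} (x : G g h a b c d e f) : G a b c d e f g h := r1 (r5 x)
theorem r7 {a b c d e f g h : ℕ} (x : G h a b c d e f g) : G a b c d e f g h := r1 (r6 x)

section options
variable {p0 p1 p2 p3 p4 p5 p6 p7 : ℕ}

theorem mkG (x a₁ b₁ e b₂ a₂ : ℕ) (h1 : x ≤ p1) (h7 : x ≤ p7) (h2 : a₁ ≤ p2) (h3 : b₁ ≤ p3)
    (h4 : e ≤ p4) (h5 : b₂ ≤ p5) (h6 : a₂ ≤ p6) (s1 : a₁ + b₁ = x) (s2 : b₂ + a₂ = x)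
    (s3 : e = min x (a₁ + a₂)) (hp : Pr p0 p1 p2 p3 p4 p5 p6 p7 0 x a₁ b₁ e b₂ a₂ x) :
    G p0 p1 p2 p3 p4 p5 p6 p7 :=
  ⟨0, x, a₁, b₁, e, b₂, a₂, x, ⟨Nat.zero_le _, h1, h2, h3, h4, h5, h6, h7⟩, hp,
    Or.inl ⟨rfl, rfl, s1, s2, s3⟩⟩

/-- Stacks 0 and 1 are kept. -/
theorem optA (h0 : p0 ≤ 0) (h7 : p1 ≤ p7) (h23 : p1 ≤ p2 + p3) (h56 : p1 ≤ p5 + p6)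
    (h4 : min p1 ((p1 - p3) + (p1 - p5)) ≤ p4) : G p0 p1 p2 p3 p4 p5 p6 p7 := by
  refine mkG p1 (p1 - p3) (p1 - (p1 - p3)) (min p1 ((p1 - p3) + (p1 - p5)))
    (p1 - (p1 - p5)) (p1 - p5) ?_ ?_ ?_ ?_ ?_ ?_ ?_ ?_ ?_ ?_ (Or.inl ?_) <;> omega

theorem optA1 (h0 : p0 ≤ 0) (h7 : p1 ≤ p7) (h23 : p1 ≤ p2 + p3) (h56 : p1 ≤ p5 + p6)
    (h4 : p1 ≤ p4) : G p0 p1 p2 p3 p4 p5 p6 p7 := optA h0 h7 h23 h56 (by omega)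

theorem optA2 (h0 : p0 ≤ 0) (h7 : p1 ≤ p7) (h23 : p1 ≤ p2 + p3) (h56 : p1 ≤ p5 + p6)
    (h4 : p1 + p1 ≤ p4 + p3 + p5) (h43 : p1 ≤ p4 + p3) (h45 : p1 ≤ p4 + p5) :
    G p0 p1 p2 p3 p4 p5 p6 p7 := optA h0 h7 h23 h56 (by omega)

/-- Stacks 2 and 3 are kept. -/
theorem optB (h1 : p2 + p3 ≤ p1) (h7 : p2 + p3 ≤ p7) (h56 : p2 + p3 ≤ p5 + p6)
    (h4 : min (p2 + p3) (p2 + (p2 + p3 - p5)) ≤ p4) : G p0 p1 p2 p3 p4 p5 p6 p7 := by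
  refine mkG (p2 + p3) p2 p3 (min (p2 + p3) (p2 + (p2 + p3 - p5)))
    (p2 + p3 - (p2 + p3 - p5)) (p2 + p3 - p5) ?_ ?_ ?_ ?_ ?_ ?_ ?_ ?_ ?_ ?_
    (Or.inr (Or.inr (Or.inl ?_))) <;> omega

theorem optB1 (h1 : p2 + p3 ≤ p1) (h7 : p2 + p3 ≤ p7) (h56 : p2 + p3 ≤ p5 + p6)
    (h4 : p2 + p3 ≤ p4) : G p0 p1 p2 p3 p4 p5 p6 p7 := optB h1 h7 h56 (by omega)

theorem optB2 (h1 : p2 + p3 ≤ p1) (h7 : p2 + p3 ≤ p7) (h56 : p2 + p3 ≤ p5 + p6)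
    (h4 : p2 ≤ p4) (h45 : p2 + p2 + p3 ≤ p4 + p5) : G p0 p1 p2 p3 p4 p5 p6 p7 :=
  optB h1 h7 h56 (by omega)

/-- Stacks 1 and 2 are kept. -/
theorem optC (h12 : p2 ≤ p1) (h23 : p1 ≤ p2 + p3) (h7 : p1 ≤ p7) (h56 : p1 ≤ p5 + p6)
    (h4 : min p1 (p2 + (p1 - p5)) ≤ p4) : G p0 p1 p2 p3 p4 p5 p6 p7 := by
  refine mkG p1 p2 (p1 - p2) (min p1 (p2 + (p1 - p5)))
    (p1 - (p1 - p5)) (p1 - p5) ?_ ?_ ?_ ?_ ?_ ?_ ?_ ?_ ?_ ?_ (Or.inr (Or.inl ?_)) <;> omega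

theorem optC1 (h12 : p2 ≤ p1) (h23 : p1 ≤ p2 + p3) (h7 : p1 ≤ p7) (h56 : p1 ≤ p5 + p6)
    (h4 : p1 ≤ p4) : G p0 p1 p2 p3 p4 p5 p6 p7 := optC h12 h23 h7 h56 (by omega)

theorem optC2 (h12 : p2 ≤ p1) (h23 : p1 ≤ p2 + p3) (h7 : p1 ≤ p7) (h56 : p1 ≤ p5 + p6)
    (h4 : p2 ≤ p4) (h45 : p2 + p1 ≤ p4 + p5) : G p0 p1 p2 p3 p4 p5 p6 p7 :=
  optC h12 h23 h7 h56 (by omega)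

/-- Stacks 3 and 4 are kept, with `x = p4`. -/
theorem optD1 (h34 : p3 ≤ p4) (h1 : p4 ≤ p1) (h7 : p4 ≤ p7) (h2 : p4 ≤ p2 + p3)
    (h56 : p4 ≤ p5 + p6) (h36 : p3 ≤ p6) : G p0 p1 p2 p3 p4 p5 p6 p7 := by
  refine mkG p4 (p4 - p3) p3 p4 (p4 - max p3 (p4 - p5)) (max p3 (p4 - p5))
    ?_ ?_ ?_ ?_ ?_ ?_ ?_ ?_ ?_ ?_ (Or.inr (Or.inr (Or.inr (Or.inl ?_)))) <;> omega

/-- Stacks 3 and 4 are kept, with `x = p3 + p4 - a₂`. -/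
theorem optD2 (h31 : p4 ≤ p1) (h37 : p4 ≤ p7) (h32 : p4 ≤ p2 + p3) (h35 : p4 ≤ p3 + p5)
    (h41 : p3 ≤ p1) (h47 : p3 ≤ p7) (h45 : p3 ≤ p4 + p5)
    (h61 : p3 + p4 ≤ p6 + p1) (h67 : p3 + p4 ≤ p6 + p7) (h62 : p4 ≤ p6 + p2)
    (h65 : p3 + p4 ≤ p6 + p6 + p5) : G p0 p1 p2 p3 p4 p5 p6 p7 := by
  obtain ⟨a, ha⟩ : ∃ a, a = min p3 (min p4 p6) := ⟨_, rfl⟩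
  refine mkG (p3 + p4 - a) (p4 - a) p3 p4 (p3 + p4 - a - a) a
    ?_ ?_ ?_ ?_ ?_ ?_ ?_ ?_ ?_ ?_ (Or.inr (Or.inr (Or.inr (Or.inl ?_)))) <;> omega

end options

/-- The main covering argument: the pair `a, b` has the least sum, and `a ≤ b`. -/
theorem cover {a b c d e f g h : ℕ} (_ : a + b ≤ b + c) (_ : a + b ≤ c + d)
    (_ : a + b ≤ d + e) (_ : a + b ≤ e + f) (_ : a + b ≤ f + g) (_ : a + b ≤ g + h)
    (_ : a + b ≤ h + a) (_ : a ≤ b) : G a b c d e f g h := by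
  by_contra hn
  have : 0 < b := by
    by_contra; refine hn (r1 (rf (optA2 ?_ ?_ ?_ ?_ ?_ ?_ ?_))) <;> omega
  rcases le_or_gt (b) (e) with _ | _
  · have : 0 < a := by
      by_contra; refine hn (optA1 ?_ ?_ ?_ ?_ ?_) <;> omega
    have : b < c := by
      by_contra; refine hn (optC1 ?_ ?_ ?_ ?_ ?_) <;> omega
    rcases le_or_gt (a) (d) with _ | _
    · have : g < b := by
        by_contra; refine hn (r5 (optD1 ?_ ?_ ?_ ?_ ?_ ?_)) <;> omega
      rcases le_or_gt (a+b) (h) with _ | _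
      · rcases le_or_gt (a+b) (c) with _ | _
        · have : e < a+b := by
            by_contra; refine hn (r3 (rf (optB1 ?_ ?_ ?_ ?_))) <;> omega
          have : e < f := by
            by_contra; refine hn (r3 (optC1 ?_ ?_ ?_ ?_ ?_)) <;> omega
          have : f < a+b := by
            by_contra; refine hn (r6 (optB1 ?_ ?_ ?_ ?_)) <;> omega
          refine hn (r6 (rf (optC1 ?_ ?_ ?_ ?_ ?_))) <;> omega
        · have : e < c := by
            by_contra; refine hn (r3 (rf (optC1 ?_ ?_ ?_ ?_ ?_))) <;> omega
          have : e < f := by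
            by_contra; refine hn (r3 (optC1 ?_ ?_ ?_ ?_ ?_)) <;> omega
          have : f < c := by
            by_contra; refine hn (r6 (optD1 ?_ ?_ ?_ ?_ ?_ ?_)) <;> omega
          refine hn (r6 (rf (optC1 ?_ ?_ ?_ ?_ ?_))) <;> omega
      · rcases le_or_gt (h) (c) with _ | _
        · have : e < h := by
            by_contra; refine hn (r3 (optD1 ?_ ?_ ?_ ?_ ?_ ?_)) <;> omega
          have : e < f := by
            by_contra; refine hn (r3 (optC1 ?_ ?_ ?_ ?_ ?_)) <;> omega
          have : f < h := by
            by_contra; refine hn (r6 (optC1 ?_ ?_ ?_ ?_ ?_)) <;> omega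
          refine hn (r6 (rf (optC1 ?_ ?_ ?_ ?_ ?_))) <;> omega
        · have : e < c := by
            by_contra; refine hn (r3 (rf (optC1 ?_ ?_ ?_ ?_ ?_))) <;> omega
          have : e < f := by
            by_contra; refine hn (r3 (optC1 ?_ ?_ ?_ ?_ ?_)) <;> omega
          have : f < c := by
            by_contra; refine hn (r6 (optD1 ?_ ?_ ?_ ?_ ?_ ?_)) <;> omega
          refine hn (r6 (rf (optC1 ?_ ?_ ?_ ?_ ?_))) <;> omega
    · rcases le_or_gt (h) (a) with _ | _
      · have : h < g := by
          by_contra; refine hn (rf (optC1 ?_ ?_ ?_ ?_ ?_)) <;> omega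
        have : f < a := by
          by_contra; refine hn (r1 (rf (optC1 ?_ ?_ ?_ ?_ ?_))) <;> omega
        have : c+f < a+h := by
          by_contra; refine hn (r3 (rf (optD2 ?_ ?_ ?_ ?_ ?_ ?_ ?_ ?_ ?_ ?_ ?_))) <;> omega
        refine hn (r3 (rf (optC2 ?_ ?_ ?_ ?_ ?_ ?_))) <;> omega
      · rcases le_or_gt (a+b) (c) with _ | _
        · rcases le_or_gt (a+b) (e) with _ | _
          · have : h < a+b := by
              by_contra; refine hn (r3 (rf (optB1 ?_ ?_ ?_ ?_))) <;> omega
            have : g+h < a+b+b := by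
              by_contra; refine hn (r3 (rf (optB2 ?_ ?_ ?_ ?_ ?_))) <;> omega
            have : a+g < h := by
              by_contra; refine hn (r3 (optD2 ?_ ?_ ?_ ?_ ?_ ?_ ?_ ?_ ?_ ?_ ?_)) <;> omega
            have : b < h := by
              by_contra; refine hn (rf (optC1 ?_ ?_ ?_ ?_ ?_)) <;> omega
            refine hn (r3 (optD1 ?_ ?_ ?_ ?_ ?_ ?_)) <;> omega
          · rcases le_or_gt (f) (e) with _ | _
            · have : h < e := by
                by_contra; refine hn (r3 (optC1 ?_ ?_ ?_ ?_ ?_)) <;> omega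
              have : f < a := by
                by_contra; refine hn (r3 (rf (optD1 ?_ ?_ ?_ ?_ ?_ ?_))) <;> omega
              have : a+h < e+f := by
                by_contra; refine hn (r3 (optC2 ?_ ?_ ?_ ?_ ?_ ?_)) <;> omega
              refine hn (r3 (rf (optD2 ?_ ?_ ?_ ?_ ?_ ?_ ?_ ?_ ?_ ?_ ?_))) <;> omega
            · rcases le_or_gt (a+b) (h) with _ | _
              · have : f < a+b := by
                  by_contra; refine hn (r6 (optB1 ?_ ?_ ?_ ?_)) <;> omega
                refine hn (r6 (rf (optC1 ?_ ?_ ?_ ?_ ?_))) <;> omega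
              · have : e < h := by
                  by_contra; refine hn (r3 (rf (optD1 ?_ ?_ ?_ ?_ ?_ ?_))) <;> omega
                have : f < h := by
                  by_contra; refine hn (r6 (optC1 ?_ ?_ ?_ ?_ ?_)) <;> omega
                refine hn (r6 (rf (optC1 ?_ ?_ ?_ ?_ ?_))) <;> omega
        · rcases le_or_gt (c) (h) with _ | _
          · have : e < c := by
              by_contra; refine hn (r3 (rf (optC1 ?_ ?_ ?_ ?_ ?_))) <;> omega
            have : e < f := by
              by_contra; refine hn (r3 (optC1 ?_ ?_ ?_ ?_ ?_)) <;> omega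
            have : f < c := by
              by_contra; refine hn (r6 (optD1 ?_ ?_ ?_ ?_ ?_ ?_)) <;> omega
            refine hn (r6 (rf (optC1 ?_ ?_ ?_ ?_ ?_))) <;> omega
          · have : f < h := by
              by_contra; refine hn (r6 (optC1 ?_ ?_ ?_ ?_ ?_)) <;> omega
            have : f < e := by
              by_contra; refine hn (r6 (rf (optC1 ?_ ?_ ?_ ?_ ?_))) <;> omega
            rcases le_or_gt (h) (e) with _ | _
            · have : f < a := by
                by_contra; refine hn (r3 (rf (optD1 ?_ ?_ ?_ ?_ ?_ ?_))) <;> omega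
              have : d+g < a+b := by
                by_contra; refine hn (r5 (optD2 ?_ ?_ ?_ ?_ ?_ ?_ ?_ ?_ ?_ ?_ ?_)) <;> omega
              rcases le_or_gt (h) (b) with _ | _
              · refine hn (r3 (optD2 ?_ ?_ ?_ ?_ ?_ ?_ ?_ ?_ ?_ ?_ ?_)) <;> omega
              · rcases le_or_gt (b+c) (g+h) with _ | _
                · have : e < c := by
                    by_contra; refine hn (r3 (rf (optC2 ?_ ?_ ?_ ?_ ?_ ?_))) <;> omega
                  have : h < e := by
                    by_contra; refine hn (r3 (optC1 ?_ ?_ ?_ ?_ ?_)) <;> omega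
                  have : a+h < e+f := by
                    by_contra; refine hn (r3 (optC2 ?_ ?_ ?_ ?_ ?_ ?_)) <;> omega
                  refine hn (r3 (rf (optD2 ?_ ?_ ?_ ?_ ?_ ?_ ?_ ?_ ?_ ?_ ?_))) <;> omega
                · have : b+e < g+h := by
                    by_contra; refine hn (r3 (optD2 ?_ ?_ ?_ ?_ ?_ ?_ ?_ ?_ ?_ ?_ ?_)) <;> omega
                  have : h < e := by
                    by_contra; refine hn (r3 (optC1 ?_ ?_ ?_ ?_ ?_)) <;> omega
                  have : a+h < e+f := by
                    by_contra; refine hn (r3 (optC2 ?_ ?_ ?_ ?_ ?_ ?_)) <;> omega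
                  refine hn (r3 (rf (optD2 ?_ ?_ ?_ ?_ ?_ ?_ ?_ ?_ ?_ ?_ ?_))) <;> omega
            · refine hn (r3 (optC1 ?_ ?_ ?_ ?_ ?_)) <;> omega
  · have : a < h := by
      by_contra; refine hn (r1 (rf (optC1 ?_ ?_ ?_ ?_ ?_))) <;> omega
    rcases le_or_gt (b) (d) with _ | _
    · have : 0 < a := by
        by_contra; refine hn (optA2 ?_ ?_ ?_ ?_ ?_ ?_ ?_) <;> omega
      have : g < b := by
        by_contra; refine hn (r2 (rf (optC1 ?_ ?_ ?_ ?_ ?_))) <;> omega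
      have : g < a := by
        by_contra; refine hn (r2 (rf (optC2 ?_ ?_ ?_ ?_ ?_ ?_))) <;> omega
      have : d+g < a+b := by
        by_contra; refine hn (r4 (rf (optD2 ?_ ?_ ?_ ?_ ?_ ?_ ?_ ?_ ?_ ?_ ?_))) <;> omega
      rcases le_or_gt (a+b) (h) with _ | _
      · rcases le_or_gt (a+b) (f) with _ | _
        · have : c < a+b := by
            by_contra; refine hn (r6 (optB1 ?_ ?_ ?_ ?_)) <;> omega
          have : c+d < a+a+b := by
            by_contra; refine hn (r6 (optB2 ?_ ?_ ?_ ?_ ?_)) <;> omega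
          refine hn (r6 (optD2 ?_ ?_ ?_ ?_ ?_ ?_ ?_ ?_ ?_ ?_ ?_)) <;> omega
        · have : c < f := by
            by_contra; refine hn (r6 (rf (optC1 ?_ ?_ ?_ ?_ ?_))) <;> omega
          rcases le_or_gt (d) (c) with _ | _
          · have : b+c < e+f := by
              by_contra; refine hn (r6 (rf (optC2 ?_ ?_ ?_ ?_ ?_ ?_))) <;> omega
            refine hn (r6 (optD2 ?_ ?_ ?_ ?_ ?_ ?_ ?_ ?_ ?_ ?_ ?_)) <;> omega
          · rcases le_or_gt (c) (e) with _ | _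
            · refine hn (optC2 ?_ ?_ ?_ ?_ ?_ ?_) <;> omega
            · have : b+c < e+f := by
                by_contra; refine hn (r6 (rf (optC2 ?_ ?_ ?_ ?_ ?_ ?_))) <;> omega
              refine hn (r6 (optD2 ?_ ?_ ?_ ?_ ?_ ?_ ?_ ?_ ?_ ?_ ?_)) <;> omega
      · rcases le_or_gt (h) (f) with _ | _
        · have : c < h := by
            by_contra; refine hn (r6 (optC1 ?_ ?_ ?_ ?_ ?_)) <;> omega
          have : c+d < a+h := by
            by_contra; refine hn (r6 (optC2 ?_ ?_ ?_ ?_ ?_ ?_)) <;> omega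
          refine hn (r6 (optD2 ?_ ?_ ?_ ?_ ?_ ?_ ?_ ?_ ?_ ?_ ?_)) <;> omega
        · have : c < f := by
            by_contra; refine hn (r6 (rf (optC1 ?_ ?_ ?_ ?_ ?_))) <;> omega
          rcases le_or_gt (c) (e) with _ | _
          · refine hn (optC2 ?_ ?_ ?_ ?_ ?_ ?_) <;> omega
          · have : b+c < e+f := by
              by_contra; refine hn (r6 (rf (optC2 ?_ ?_ ?_ ?_ ?_ ?_))) <;> omega
            refine hn (r6 (optD2 ?_ ?_ ?_ ?_ ?_ ?_ ?_ ?_ ?_ ?_ ?_)) <;> omega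
    · rcases le_or_gt (d) (g) with _ | _
      · have : e < d := by
          by_contra; refine hn (optD1 ?_ ?_ ?_ ?_ ?_ ?_) <;> omega
        refine hn (optD2 ?_ ?_ ?_ ?_ ?_ ?_ ?_ ?_ ?_ ?_ ?_) <;> omega
      · rcases le_or_gt (e) (g) with _ | _
        · refine hn (optD2 ?_ ?_ ?_ ?_ ?_ ?_ ?_ ?_ ?_ ?_ ?_) <;> omega
        · rcases le_or_gt (f) (e) with _ | _
          · have : c < f := by
              by_contra; refine hn (rf (optD1 ?_ ?_ ?_ ?_ ?_ ?_)) <;> omega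
            have : e+f < b+c := by
              by_contra; refine hn (optC2 ?_ ?_ ?_ ?_ ?_ ?_) <;> omega
            refine hn (rf (optD2 ?_ ?_ ?_ ?_ ?_ ?_ ?_ ?_ ?_ ?_ ?_)) <;> omega
          · rcases le_or_gt (a) (0) with _ | _
            · have : d+e+f < b+b := by
                by_contra; refine hn (optA2 ?_ ?_ ?_ ?_ ?_ ?_ ?_) <;> omega
              refine hn (optD2 ?_ ?_ ?_ ?_ ?_ ?_ ?_ ?_ ?_ ?_ ?_) <;> omega
            · rcases le_or_gt (a+b) (h) with _ | _
              · rcases le_or_gt (a+b) (f) with _ | _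
                · have : c < a+b := by
                    by_contra; refine hn (r6 (optB1 ?_ ?_ ?_ ?_)) <;> omega
                  have : c+d < a+a+b := by
                    by_contra; refine hn (r6 (optB2 ?_ ?_ ?_ ?_ ?_)) <;> omega
                  refine hn (r6 (optD2 ?_ ?_ ?_ ?_ ?_ ?_ ?_ ?_ ?_ ?_ ?_)) <;> omega
                · have : c < f := by
                    by_contra; refine hn (r6 (rf (optC1 ?_ ?_ ?_ ?_ ?_))) <;> omega
                  rcases le_or_gt (c) (e) with _ | _
                  · have : e+f < b+c := by
                      by_contra; refine hn (optC2 ?_ ?_ ?_ ?_ ?_ ?_) <;> omega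
                    refine hn (rf (optD2 ?_ ?_ ?_ ?_ ?_ ?_ ?_ ?_ ?_ ?_ ?_)) <;> omega
                  · have : b+c < e+f := by
                      by_contra; refine hn (r6 (rf (optC2 ?_ ?_ ?_ ?_ ?_ ?_))) <;> omega
                    refine hn (r6 (optD2 ?_ ?_ ?_ ?_ ?_ ?_ ?_ ?_ ?_ ?_ ?_)) <;> omega
              · rcases le_or_gt (h) (f) with _ | _
                · have : c < h := by
                    by_contra; refine hn (r6 (optC1 ?_ ?_ ?_ ?_ ?_)) <;> omega
                  have : c+d < a+h := by
                    by_contra; refine hn (r6 (optC2 ?_ ?_ ?_ ?_ ?_ ?_)) <;> omega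
                  refine hn (r6 (optD2 ?_ ?_ ?_ ?_ ?_ ?_ ?_ ?_ ?_ ?_ ?_)) <;> omega
                · have : c < f := by
                    by_contra; refine hn (r6 (rf (optC1 ?_ ?_ ?_ ?_ ?_))) <;> omega
                  rcases le_or_gt (c) (e) with _ | _
                  · have : e+f < b+c := by
                      by_contra; refine hn (optC2 ?_ ?_ ?_ ?_ ?_ ?_) <;> omega
                    refine hn (rf (optD2 ?_ ?_ ?_ ?_ ?_ ?_ ?_ ?_ ?_ ?_ ?_)) <;> omega
                  · have : b+c < e+f := by
                      by_contra; refine hn (r6 (rf (optC2 ?_ ?_ ?_ ?_ ?_ ?_))) <;> omega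
                    refine hn (r6 (optD2 ?_ ?_ ?_ ?_ ?_ ?_ ?_ ?_ ?_ ?_ ?_)) <;> omega

theorem cover' {a b c d e f g h : ℕ} (h1 : a + b ≤ b + c) (h2 : a + b ≤ c + d)
    (h3 : a + b ≤ d + e) (h4 : a + b ≤ e + f) (h5 : a + b ≤ f + g) (h6 : a + b ≤ g + h)
    (h7 : a + b ≤ h + a) : G a b c d e f g h := by
  rcases le_total a b with hab | hab
  · exact cover h1 h2 h3 h4 h5 h6 h7 hab
  · refine r1 (rf (cover ?_ ?_ ?_ ?_ ?_ ?_ ?_ hab)) <;> omega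

theorem zcases_s7 (i : ZMod 8) :
    i = 0 ∨ i = 1 ∨ i = 2 ∨ i = 3 ∨ i = 4 ∨ i = 5 ∨ i = 6 ∨ i = 7 := by
  revert i; decide

theorem allG (p : ZMod 8 → ℕ) : G (p 0) (p 1) (p 2) (p 3) (p 4) (p 5) (p 6) (p 7) := by
  obtain ⟨i, hi⟩ := Finite.exists_min (fun i : ZMod 8 => p i + p (i + 1))
  have h0 : _ ≤ p 0 + p 1 := hi 0
  have h1 : _ ≤ p 1 + p 2 := hi 1
  have h2 : _ ≤ p 2 + p 3 := hi 2
  have h3 : _ ≤ p 3 + p 4 := hi 3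
  have h4 : _ ≤ p 4 + p 5 := hi 4
  have h5 : _ ≤ p 5 + p 6 := hi 5
  have h6 : _ ≤ p 6 + p 7 := hi 6
  have h7 : _ ≤ p 7 + p 0 := hi 7
  clear hi
  rcases zcases_s7 i with rfl | rfl | rfl | rfl | rfl | rfl | rfl | rfl
  · exact cover' h1 h2 h3 h4 h5 h6 h7
  · exact r1 (cover' h2 h3 h4 h5 h6 h7 h0)
  · exact r2 (cover' h3 h4 h5 h6 h7 h0 h1)
  · exact r3 (cover' h4 h5 h6 h7 h0 h1 h2)
  · exact r4 (cover' h5 h6 h7 h0 h1 h2 h3)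
  · exact r5 (cover' h6 h7 h0 h1 h2 h3 h4)
  · exact r6 (cover' h7 h0 h1 h2 h3 h4 h5)
  · exact r7 (cover' h0 h1 h2 h3 h4 h5 h6)

/-- The normal form read off from a function on `ZMod 8`. -/
def FormF (q : ZMod 8 → ℕ) : Prop :=
  q 0 = 0 ∧ q 1 = q 7 ∧ q 2 + q 3 = q 1 ∧ q 5 + q 6 = q 1 ∧ q 4 = min (q 1) (q 2 + q 6)

/-- Membership in the set only needs rotations. -/
theorem mem_rot {p : ZMod 8 → ℕ} (h : ∃ q : ZMod 8 → ℕ, IsSymmPos 8 p q ∧ FormF q) :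
    ∃ l : ZMod 8, FormF (fun j => p (j + l)) := by
  obtain ⟨q, ⟨l, hl | hl⟩, hq⟩ := h
  · refine ⟨l, ?_⟩
    rwa [← (funext hl : q = _)]
  · refine ⟨l, ?_⟩
    have e : ∀ j, p (j + l) = q (-j) := by
      intro j; rw [hl]; congr 1; ring
    simp only [e]
    have x : Form (q 0) (q 1) (q 2) (q 3) (q 4) (q 5) (q 6) (q 7) := hq
    exact x.refl

theorem mem_InS {p : ZMod 8 → ℕ} :
    (∃ l : ZMod 8, FormF (fun j => p (j + l))) ↔
      InS (p 0) (p 1) (p 2) (p 3) (p 4) (p 5) (p 6) (p 7) := by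
  constructor
  · rintro ⟨l, hl⟩
    rcases zcases_s7 l with rfl | rfl | rfl | rfl | rfl | rfl | rfl | rfl
    · exact Or.inl hl
    · exact Or.inr (Or.inl hl)
    · exact Or.inr (Or.inr (Or.inl hl))
    · exact Or.inr (Or.inr (Or.inr (Or.inl hl)))
    · exact Or.inr (Or.inr (Or.inr (Or.inr (Or.inl hl))))
    · exact Or.inr (Or.inr (Or.inr (Or.inr (Or.inr (Or.inl hl)))))
    · exact Or.inr (Or.inr (Or.inr (Or.inr (Or.inr (Or.inr (Or.inl hl))))))
    · exact Or.inr (Or.inr (Or.inr (Or.inr (Or.inr (Or.inr (Or.inr hl))))))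
  · rintro (h | h | h | h | h | h | h | h)
    exacts [⟨0, h⟩, ⟨1, h⟩, ⟨2, h⟩, ⟨3, h⟩, ⟨4, h⟩, ⟨5, h⟩, ⟨6, h⟩, ⟨7, h⟩]

theorem arc_compl : ∀ m j : ZMod 8, (∀ t : ℕ, t < 6 → j ≠ m + 2 + (t : ZMod 8)) →
    j = m ∨ j = m + 1 := by
  decide

theorem arc_compl' : ∀ i : ZMod 8, (∀ t : ℕ, t < 6 → i + 6 ≠ i + (t : ZMod 8)) ∧
    (∀ t : ℕ, t < 6 → i + 6 + 1 ≠ i + (t : ZMod 8)) := by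
  decide

theorem pr_iff (p p' : ZMod 8 → ℕ) : (∃ m, p' m = p m ∧ p' (m + 1) = p (m + 1)) ↔
    Pr (p 0) (p 1) (p 2) (p 3) (p 4) (p 5) (p 6) (p 7)
      (p' 0) (p' 1) (p' 2) (p' 3) (p' 4) (p' 5) (p' 6) (p' 7) := by
  constructor
  · rintro ⟨m, hm⟩
    rcases zcases_s7 m with rfl | rfl | rfl | rfl | rfl | rfl | rfl | rfl
    · exact Or.inl hm
    · exact Or.inr (Or.inl hm)
    · exact Or.inr (Or.inr (Or.inl hm))
    · exact Or.inr (Or.inr (Or.inr (Or.inl hm)))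
    · exact Or.inr (Or.inr (Or.inr (Or.inr (Or.inl hm))))
    · exact Or.inr (Or.inr (Or.inr (Or.inr (Or.inr (Or.inl hm)))))
    · exact Or.inr (Or.inr (Or.inr (Or.inr (Or.inr (Or.inr (Or.inl hm))))))
    · exact Or.inr (Or.inr (Or.inr (Or.inr (Or.inr (Or.inr (Or.inr hm))))))
  · rintro (h | h | h | h | h | h | h | h)
    exacts [⟨0, h⟩, ⟨1, h⟩, ⟨2, h⟩, ⟨3, h⟩, ⟨4, h⟩, ⟨5, h⟩, ⟨6, h⟩, ⟨7, h⟩]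

/-- Condition (I) in coordinates. -/
theorem rigid_s7 {a b c d e f g h a' b' c' d' e' f' g' h' : ℕ} (hf : Form a b c d e f g h)
    (hs : InS a' b' c' d' e' f' g' h')
    (hle : a' ≤ a ∧ b' ≤ b ∧ c' ≤ c ∧ d' ≤ d ∧ e' ≤ e ∧ f' ≤ f ∧ g' ≤ g ∧ h' ≤ h)
    (hp : Pr a b c d e f g h a' b' c' d' e' f' g' h') :
    a' = a ∧ b' = b ∧ c' = c ∧ d' = d ∧ e' = e ∧ f' = f ∧ g' = g ∧ h' = h := by
  unfold Form at hf
  unfold InS Form at hs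
  unfold Pr at hp
  obtain ⟨l0, l1, l2, l3, l4, l5, l6, l7⟩ := hle
  obtain ⟨f0, f1, f2, f3, f4⟩ := hf
  rcases hs with hs | hs | hs | hs | hs | hs | hs | hs <;>
  rcases hp with hp | hp | hp | hp | hp | hp | hp | hp <;>
  omega

theorem CN_8_6_losing :
    CondI 8 6 {p : ZMod 8 → ℕ | ∃ q : ZMod 8 → ℕ, IsSymmPos 8 p q ∧
      q 0 = 0 ∧ q 1 = q 7 ∧ q 2 + q 3 = q 1 ∧ q 5 + q 6 = q 1 ∧
      q 4 = min (q 1) (q 2 + q 6)} ∧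
    CondII 8 6 {p : ZMod 8 → ℕ | ∃ q : ZMod 8 → ℕ, IsSymmPos 8 p q ∧
      q 0 = 0 ∧ q 1 = q 7 ∧ q 2 + q 3 = q 1 ∧ q 5 + q 6 = q 1 ∧
      q 4 = min (q 1) (q 2 + q 6)} := by
  constructor
  · intro p hp p' hmv hp'
    obtain ⟨l, hl⟩ := mem_rot hp
    obtain ⟨l', hl'⟩ := mem_rot hp'
    obtain ⟨i, hle, heq, hne⟩ := hmv
    apply hne
    have hs : InS (p' (0 + l)) (p' (1 + l)) (p' (2 + l)) (p' (3 + l)) (p' (4 + l)) (p' (5 + l))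
        (p' (6 + l)) (p' (7 + l)) := by
      refine (mem_InS (p := fun j => p' (j + l))).1 ⟨l' - l, ?_⟩
      simpa only [add_assoc, sub_add_cancel] using hl'
    have hpr := (pr_iff (fun j => p (j + l)) (fun j => p' (j + l))).1 ⟨i + 6 - l, by
      have e1 : i + 6 - l + l = i + 6 := by ring
      have e2 : i + 6 - l + 1 + l = i + 6 + 1 := by ring
      simp only [e1, e2]
      exact ⟨heq _ (arc_compl' i).1, heq _ (arc_compl' i).2⟩⟩
    obtain ⟨h0, h1, h2, h3, h4, h5, h6, h7⟩ := rigid_s7 hl hs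
      ⟨hle _, hle _, hle _, hle _, hle _, hle _, hle _, hle _⟩ hpr
    funext j
    have hj : j = (j - l) + l := by ring
    rw [hj]
    rcases zcases_s7 (j - l) with h | h | h | h | h | h | h | h <;> rw [h] <;> assumption
  · intro p hp
    obtain ⟨a', b', c', d', e', f', g', h', hle, hpr, hs⟩ := allG p
    obtain ⟨p', hp'⟩ : ∃ p' : ZMod 8 → ℕ, p' = (![a', b', c', d', e', f', g', h'] : Fin 8 → ℕ) :=
      ⟨_, rfl⟩
    have k0 : p' 0 = a' := by rw [hp']; rfl
    have k1 : p' 1 = b' := by rw [hp']; rfl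
    have k2 : p' 2 = c' := by rw [hp']; rfl
    have k3 : p' 3 = d' := by rw [hp']; rfl
    have k4 : p' 4 = e' := by rw [hp']; rfl
    have k5 : p' 5 = f' := by rw [hp']; rfl
    have k6 : p' 6 = g' := by rw [hp']; rfl
    have k7 : p' 7 = h' := by rw [hp']; rfl
    clear hp'
    subst k0 k1 k2 k3 k4 k5 k6 k7
    obtain ⟨m, hm⟩ := (pr_iff p p').2 hpr
    obtain ⟨l, hl⟩ := mem_InS.2 hs
    have hmem : ∃ q : ZMod 8 → ℕ, IsSymmPos 8 p' q ∧ FormF q :=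
      ⟨_, ⟨l, Or.inl fun _ => rfl⟩, hl⟩
    refine ⟨p', ⟨m + 2, ?_, ?_, ?_⟩, hmem⟩
    · obtain ⟨h0, h1, h2, h3, h4, h5, h6, h7⟩ := hle
      intro j
      rcases zcases_s7 j with h | h | h | h | h | h | h | h <;> rw [h] <;> assumption
    · intro j hj
      rcases arc_compl m j hj with rfl | rfl
      · exact hm.1
      · exact hm.2
    · rintro rfl
      exact hp hmem
end
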